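/- arXiv:1602.07035 — 4 statements merged into one kernel-verified Lean document; each statement's English description precedes it below -/
import Mathlib

section
/- Let R be an integral domain and ⋆ a star operation on R. If a nonzero ideal I of R is ⋆-invertible, i.e., (I·I⁻¹)^⋆ = R, then I is ⋆-basic: every ⋆-reduction J of I satisfies J^⋆ = I^⋆. -/
open scoped nonZeroDivisors

open FractionalIdeal

/-- A star operation on an integral domain `R` with quotient field `K`, viewed as a map on
fractional ideals.  The defining axioms are only imposed on nonzero fractional ideals, since a
star operation is classically defined on the set of nonzero fractional ideals. -/
structure StarOperation (R K : Type*) [CommRing R] [IsDomain R] [Field K]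
    [Algebra R K] [IsFractionRing R K] where
  star : FractionalIdeal R⁰ K → FractionalIdeal R⁰ K
  star_one : star 1 = 1
  star_smul : ∀ (a : K), a ≠ 0 → ∀ I : FractionalIdeal R⁰ K, I ≠ 0 →
    star (spanSingleton R⁰ a * I) = spanSingleton R⁰ a * star I
  le_star : ∀ I : FractionalIdeal R⁰ K, I ≠ 0 → I ≤ star I
  star_mono : ∀ I J : FractionalIdeal R⁰ K, I ≠ 0 → J ≠ 0 → I ≤ J → star I ≤ star J
  star_star : ∀ I : FractionalIdeal R⁰ K, I ≠ 0 → star (star I) = star I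

theorem fracIdeal_noZeroDivisors (R K : Type*) [CommRing R] [IsDomain R] [Field K] [Algebra R K]
    [IsFractionRing R K] : NoZeroDivisors (FractionalIdeal R⁰ K) := by
  constructor
  intro A B h
  by_contra! hc
  obtain ⟨hA, hB⟩ := hc
  apply hA
  rw [FractionalIdeal.eq_zero_iff]
  intro a ha
  by_contra ha0
  apply hB
  rw [FractionalIdeal.eq_zero_iff]
  intro b hb
  have h1 : a * b ∈ A * B := FractionalIdeal.mul_mem_mul ha hb
  rw [h, FractionalIdeal.mem_zero_iff] at h1
  exact (mul_eq_zero.mp h1).resolve_left ha0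

theorem StarOperation.mul_star_le {R K : Type*} [CommRing R] [IsDomain R] [Field K] [Algebra R K]
    [IsFractionRing R K] (s : StarOperation R K) (A B : FractionalIdeal R⁰ K) (hA : A ≠ 0)
    (hB : B ≠ 0) : A * s.star B ≤ s.star (A * B) := by
  have := fracIdeal_noZeroDivisors R K
  rw [FractionalIdeal.mul_le]
  intro a ha b hb
  by_cases h0 : a = 0
  · subst h0
    rw [zero_mul]
    exact (s.star (A * B) : Submodule R K).zero_mem
  have h1 : spanSingleton R⁰ a * B ≤ A * B :=
    mul_le_mul_left (spanSingleton_le_iff_mem.mpr ha) B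
  have h2 := s.star_mono _ _ (mul_ne_zero (spanSingleton_ne_zero_iff.mpr h0) hB)
    (mul_ne_zero hA hB) h1
  rw [s.star_smul a h0 B hB] at h2
  exact h2 (FractionalIdeal.mul_mem_mul (mem_spanSingleton_self _ a) hb)

/-- If a nonzero ideal `I` of `R` is `⋆`-invertible, i.e. `(I·I⁻¹)^⋆ = R`, then `I` is
`⋆`-basic: every `⋆`-reduction `J` of `I` satisfies `J^⋆ = I^⋆`. -/
theorem star_basic_of_star_invertible
    {R K : Type*} [CommRing R] [IsDomain R] [Field K] [Algebra R K] [IsFractionRing R K]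
    (s : StarOperation R K) (I : Ideal R) (hI : I ≠ ⊥)
    (hinv : s.star ((I : FractionalIdeal R⁰ K) * (I : FractionalIdeal R⁰ K)⁻¹) = 1) :
    ∀ J : Ideal R, J ≠ ⊥ → J ≤ I →
      (∃ n : ℕ, s.star ((J : FractionalIdeal R⁰ K) * (I : FractionalIdeal R⁰ K) ^ n)
          = s.star ((I : FractionalIdeal R⁰ K) ^ (n + 1))) →
      s.star (J : FractionalIdeal R⁰ K) = s.star (I : FractionalIdeal R⁰ K) := by
  have := fracIdeal_noZeroDivisors R K
  intro J hJ hJI ⟨n, hn⟩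
  have hI0 : (I : FractionalIdeal R⁰ K) ≠ 0 := coeIdeal_ne_zero.mpr hI
  have hJ0 : (J : FractionalIdeal R⁰ K) ≠ 0 := coeIdeal_ne_zero.mpr hJ
  have hle : (J : FractionalIdeal R⁰ K) ≤ I := coeIdeal_le_coeIdeal K |>.mpr hJI
  have hII : (I : FractionalIdeal R⁰ K) * (I : FractionalIdeal R⁰ K)⁻¹ ≤ 1 := by
    rw [FractionalIdeal.inv_eq]
    exact mul_one_div_le_one
  have hi0 : (I : FractionalIdeal R⁰ K)⁻¹ ≠ 0 := by
    intro h
    have h1 : (1 : FractionalIdeal R⁰ K) ≤ (I : FractionalIdeal R⁰ K)⁻¹ := by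
      rw [FractionalIdeal.inv_eq, le_div_iff_mul_le hI0, one_mul]
      exact coeIdeal_le_one
    rw [h] at h1
    exact one_ne_zero (FractionalIdeal.le_zero_iff.mp h1)
  generalize (I : FractionalIdeal R⁰ K) = A at *
  generalize (J : FractionalIdeal R⁰ K) = B at *
  have key : ∀ n : ℕ, A ^ (n + 1) ≤ s.star (B * A ^ n) → A ≤ s.star B := by
    intro n
    induction n with
    | zero => intro h; simpa using h
    | succ n ih =>
      intro h
      apply ih
      have hBn : B * A ^ n ≠ 0 := mul_ne_zero hJ0 (pow_ne_zero _ hI0)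
      have hBn1 : B * A ^ (n + 1) ≠ 0 := mul_ne_zero hJ0 (pow_ne_zero _ hI0)
      have hAn : A ^ (n + 1) ≠ 0 := pow_ne_zero _ hI0
      have hAi : A * A⁻¹ ≠ 0 := mul_ne_zero hI0 hi0
      have hs : s.star (B * A ^ n) ≠ 0 := fun h0 =>
        hBn (FractionalIdeal.le_zero_iff.mp (h0 ▸ s.le_star _ hBn))
      have h1 : A ^ (n + 1) * (A * A⁻¹) ≤ s.star (B * A ^ n) := calc
        A ^ (n + 1) * (A * A⁻¹) = A⁻¹ * A ^ (n + 1 + 1) := by ring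
        _ ≤ A⁻¹ * s.star (B * A ^ (n + 1)) := mul_le_mul_right h _
        _ ≤ s.star (A⁻¹ * (B * A ^ (n + 1))) := s.mul_star_le _ _ hi0 hBn1
        _ ≤ s.star (B * A ^ n) := by
          apply s.star_mono _ _ (mul_ne_zero hi0 hBn1) hBn
          calc A⁻¹ * (B * A ^ (n + 1)) = (B * A ^ n) * (A * A⁻¹) := by ring
            _ ≤ (B * A ^ n) * 1 := mul_le_mul_right hII _
            _ = _ := mul_one _
      calc A ^ (n + 1) = A ^ (n + 1) * s.star (A * A⁻¹) := by rw [hinv, mul_one]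
        _ ≤ s.star (A ^ (n + 1) * (A * A⁻¹)) := s.mul_star_le _ _ hAn hAi
        _ ≤ s.star (s.star (B * A ^ n)) := s.star_mono _ _ (mul_ne_zero hAn hAi) hs h1
        _ = _ := s.star_star _ hBn
  have hAB : A ≤ s.star B := key n (hn ▸ s.le_star _ (pow_ne_zero _ hI0))
  apply le_antisymm (s.star_mono _ _ hJ0 hI0 hle)
  have hs : s.star B ≠ 0 := fun h0 => hJ0 (FractionalIdeal.le_zero_iff.mp (h0 ▸ s.le_star _ hJ0))
  calc s.star A ≤ s.star (s.star B) := s.star_mono _ _ hI0 hs hAB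
    _ = _ := s.star_star _ hJ0
end

section
/- An integral domain R has the v-basic ideal property (every nonzero ideal of R is v-basic) if and only if R is completely integrally closed, i.e., (I·I⁻¹)_v = R for every nonzero ideal I of R. -/
open scoped nonZeroDivisors

section helpers

variable {R K : Type*} [CommRing R] [IsDomain R] [Field K] [Algebra R K] [IsFractionRing R K]

instance vb_nzd : NoZeroDivisors (FractionalIdeal R⁰ K) where
  eq_zero_or_eq_zero_of_mul_eq_zero := by
    intro A B h
    by_contra hc
    push Not at hc
    obtain ⟨a, ha, ha0⟩ : ∃ a ∈ A, a ≠ 0 := by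
      by_contra h'
      push Not at h'
      exact hc.1 (FractionalIdeal.eq_zero_iff.2 h')
    obtain ⟨b, hb, hb0⟩ : ∃ b ∈ B, b ≠ 0 := by
      by_contra h'
      push Not at h'
      exact hc.2 (FractionalIdeal.eq_zero_iff.2 h')
    exact mul_ne_zero ha0 hb0
      (FractionalIdeal.eq_zero_iff.1 h _ (FractionalIdeal.mul_mem_mul ha hb))

lemma vb_le_inv {A B : FractionalIdeal R⁰ K} (hA : A ≠ 0) : B ≤ A⁻¹ ↔ B * A ≤ 1 := by
  rw [FractionalIdeal.inv_eq]; exact FractionalIdeal.le_div_iff_mul_le hA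

lemma vb_inv_ne {A : FractionalIdeal R⁰ K} (hA : A ≠ 0) : A⁻¹ ≠ 0 := by
  intro h
  have := FractionalIdeal.bot_lt_mul_inv (I := A) hA
  rw [h, mul_zero] at this
  exact lt_irrefl _ this

lemma vb_mul_inv_le {A : FractionalIdeal R⁰ K} (hA : A ≠ 0) : A * A⁻¹ ≤ 1 := by
  rw [mul_comm]; exact (vb_le_inv hA).1 le_rfl

lemma vb_le_v {A : FractionalIdeal R⁰ K} (hA : A ≠ 0) : A ≤ A⁻¹⁻¹ :=
  (vb_le_inv (vb_inv_ne hA)).2 (vb_mul_inv_le hA)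

lemma vb_inv3 {A : FractionalIdeal R⁰ K} (hA : A ≠ 0) : A⁻¹⁻¹⁻¹ = A⁻¹ :=
  le_antisymm (FractionalIdeal.inv_anti_mono hA (vb_inv_ne (vb_inv_ne hA)) (vb_le_v hA))
    (vb_le_v (vb_inv_ne hA))

lemma vb_inv_of_v {A B : FractionalIdeal R⁰ K} (hA : A ≠ 0) (hB : B ≠ 0)
    (h : A⁻¹⁻¹ = B⁻¹⁻¹) : A⁻¹ = B⁻¹ := by
  rw [← vb_inv3 hA, h, vb_inv3 hB]

lemma vb_mul_congr {A B C : FractionalIdeal R⁰ K} (hA : A ≠ 0) (hB : B ≠ 0) (hC : C ≠ 0)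
    (h : A⁻¹ = B⁻¹) : (A * C)⁻¹ = (B * C)⁻¹ := by
  refine eq_of_forall_le_iff fun X => ?_
  rw [vb_le_inv (mul_ne_zero hA hC), vb_le_inv (mul_ne_zero hB hC), mul_comm A, mul_comm B,
    ← mul_assoc, ← mul_assoc, ← vb_le_inv hA, ← vb_le_inv hB, h]

lemma vb_one : (1 : FractionalIdeal R⁰ K)⁻¹ = 1 := by
  rw [FractionalIdeal.inv_eq, FractionalIdeal.div_one]

end helpers

/-- An integral domain `R` has the `v`-basic ideal property (every nonzero ideal of `R` is
`v`-basic, where `A_v = (A⁻¹)⁻¹`) if and only if `R` is completely integrally closed, i.e.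
`(I·I⁻¹)_v = R` for every nonzero ideal `I` of `R`. -/
theorem v_basic_iff_completely_integrally_closed
    {R K : Type*} [CommRing R] [IsDomain R] [Field K] [Algebra R K] [IsFractionRing R K] :
    (∀ I : Ideal R, I ≠ ⊥ →
      ∀ J : Ideal R, J ≠ ⊥ → J ≤ I →
        (∃ n : ℕ, ((((J : FractionalIdeal R⁰ K) * (I : FractionalIdeal R⁰ K) ^ n)⁻¹)⁻¹)
            = ((((I : FractionalIdeal R⁰ K) ^ (n + 1))⁻¹)⁻¹)) →
        (((J : FractionalIdeal R⁰ K)⁻¹)⁻¹) = (((I : FractionalIdeal R⁰ K)⁻¹)⁻¹)) ↔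
    (∀ I : Ideal R, I ≠ ⊥ →
      (((I : FractionalIdeal R⁰ K) * (I : FractionalIdeal R⁰ K)⁻¹)⁻¹)⁻¹ = 1) := by
  constructor
  · intro H I hI
    have hI' : (I : FractionalIdeal R⁰ K) ≠ 0 := FractionalIdeal.coeIdeal_ne_zero.2 hI
    generalize (I : FractionalIdeal R⁰ K) = A at hI'
    have hiA := vb_inv_ne hI'
    have hAA : A * A⁻¹ ≠ 0 := mul_ne_zero hI' hiA
    have h1 : 1 ≤ (A * A⁻¹)⁻¹ := by
      rw [vb_le_inv hAA, one_mul]; exact vb_mul_inv_le hI'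
    have hFA : (A * A⁻¹)⁻¹ * A⁻¹ ≤ A⁻¹ := by
      rw [vb_le_inv hI', mul_assoc, mul_comm A⁻¹ A]
      exact (vb_le_inv hAA).1 le_rfl
    have hFF : (A * A⁻¹)⁻¹ * (A * A⁻¹)⁻¹ ≤ (A * A⁻¹)⁻¹ := by
      rw [vb_le_inv hAA]
      calc (A * A⁻¹)⁻¹ * (A * A⁻¹)⁻¹ * (A * A⁻¹)
          = ((A * A⁻¹)⁻¹ * A) * ((A * A⁻¹)⁻¹ * A⁻¹) := by ring
        _ ≤ ((A * A⁻¹)⁻¹ * A) * A⁻¹ := mul_le_mul_right hFA _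
        _ = (A * A⁻¹)⁻¹ * (A * A⁻¹) := by ring
        _ ≤ 1 := (vb_le_inv hAA).1 le_rfl
    have hF0 := vb_inv_ne hAA
    generalize (A * A⁻¹)⁻¹ = F at h1 hFF hF0
    have hF2 : F * F = F := le_antisymm hFF (by simpa using mul_le_mul_right h1 F)
    obtain ⟨d, L, hd, hL⟩ := FractionalIdeal.exists_eq_spanSingleton_mul F
    have hdK : algebraMap R K d ≠ 0 := by simpa using hd
    have huw : FractionalIdeal.spanSingleton R⁰ (algebraMap R K d) *
        FractionalIdeal.spanSingleton R⁰ (algebraMap R K d)⁻¹ = 1 := by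
      rw [FractionalIdeal.spanSingleton_mul_spanSingleton, mul_inv_cancel₀ hdK,
        FractionalIdeal.spanSingleton_one]
    have hJ := FractionalIdeal.coeIdeal_span_singleton (S := R⁰) (P := K) d
    rw [← hJ] at huw
    have hJ0 : Ideal.span {d} ≠ ⊥ := by simpa using hd
    have hJ0' : ((Ideal.span {d} : Ideal R) : FractionalIdeal R⁰ K) ≠ 0 :=
      FractionalIdeal.coeIdeal_ne_zero.2 hJ0
    have hLF : (L : FractionalIdeal R⁰ K) = (Ideal.span {d} : Ideal R) * F := by
      rw [hL, ← mul_assoc, huw, one_mul]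
    have hL0' : (L : FractionalIdeal R⁰ K) ≠ 0 := by rw [hLF]; exact mul_ne_zero hJ0' hF0
    have hw0 := right_ne_zero_of_mul_eq_one huw
    have key := H L (FractionalIdeal.coeIdeal_ne_zero.1 hL0') (Ideal.span {d}) hJ0 (by
        rw [← FractionalIdeal.coeIdeal_le_coeIdeal K, hLF]
        simpa using mul_le_mul_right h1 ((Ideal.span {d} : Ideal R) : FractionalIdeal R⁰ K))
      ⟨1, by
        congr 2
        rw [hLF]
        generalize ((Ideal.span {d} : Ideal R) : FractionalIdeal R⁰ K) = u
        calc u * (u * F) ^ 1 = u * u * F := by ring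
          _ = u * u * (F * F) := by rw [hF2]
          _ = _ := by ring⟩
    have := vb_mul_congr hJ0' hL0' hw0 (vb_inv_of_v hJ0' hL0' key)
    rw [huw, mul_comm (L : FractionalIdeal R⁰ K), ← hL, vb_one] at this
    exact this.symm
  · rintro H I hI J hJ - ⟨n, hn⟩
    have hc := H I hI
    have hI' : (I : FractionalIdeal R⁰ K) ≠ 0 := FractionalIdeal.coeIdeal_ne_zero.2 hI
    have hJ' : (J : FractionalIdeal R⁰ K) ≠ 0 := FractionalIdeal.coeIdeal_ne_zero.2 hJ
    generalize (I : FractionalIdeal R⁰ K) = A at *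
    generalize (J : FractionalIdeal R⁰ K) = B at *
    have hiA := vb_inv_ne hI'
    have hAA : A * A⁻¹ ≠ 0 := mul_ne_zero hI' hiA
    have hc' : (A * A⁻¹)⁻¹ = 1⁻¹ := vb_inv_of_v hAA one_ne_zero (by rw [hc, vb_one, vb_one])
    have hX : ∀ X : FractionalIdeal R⁰ K, X ≠ 0 → (X * A * A⁻¹)⁻¹ = X⁻¹ := by
      intro X hX
      have := vb_mul_congr hAA one_ne_zero hX hc'
      rwa [one_mul, mul_comm _ X, ← mul_assoc] at this
    have h2 := vb_inv_of_v (mul_ne_zero hJ' (pow_ne_zero n hI')) (pow_ne_zero (n+1) hI') hn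
    clear hn
    have h3 : B⁻¹ = A⁻¹ := by
      induction n with
      | zero => simpa using h2
      | succ n ih =>
        apply ih
        have h4 := vb_mul_congr (mul_ne_zero hJ' (pow_ne_zero (n+1) hI'))
          (pow_ne_zero (n+1+1) hI') hiA h2
        rwa [pow_succ A n, ← mul_assoc, hX _ (mul_ne_zero hJ' (pow_ne_zero n hI')),
          pow_succ A (n+1), hX _ (pow_ne_zero (n+1) hI')] at h4
    rw [h3]
end

section
/- Every v-domain has the finite t-basic ideal property: if R is an integral domain in which every nonzero finitely generated ideal I satisfies (I·I⁻¹)_v = R, then every nonzero finitely generated ideal of R is t-basic. -/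
open scoped nonZeroDivisors

/-- The `t`-operation on (nonzero) fractional ideals of `R`:
`I_t = ⋃ J_v`, where `J` ranges over the nonzero finitely generated subideals of `I` and
`J_v = (J⁻¹)⁻¹` (realized as a supremum of `R`-submodules of `K`). -/
noncomputable def tOp {R : Type*} (K : Type*) [CommRing R] [IsDomain R] [Field K]
    [Algebra R K] [IsFractionRing R K] (I : FractionalIdeal R⁰ K) : Submodule R K :=
  ⨆ (J : FractionalIdeal R⁰ K) (_ : J ≠ 0) (_ : J ≤ I) (_ : (J : Submodule R K).FG),
    (((J⁻¹)⁻¹ : FractionalIdeal R⁰ K) : Submodule R K)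

section helpers

variable {R K : Type*} [CommRing R] [IsDomain R] [Field K] [Algebra R K] [IsFractionRing R K]

theorem aux_fg (g : FractionalIdeal R⁰ K → Submodule R K) (hg : Monotone g)
    (J : FractionalIdeal R⁰ K) (N : Submodule R K) (hN : N.FG)
    (h : ∀ x ∈ N, ∃ F : FractionalIdeal R⁰ K, F ≤ J ∧ (F : Submodule R K).FG ∧ x ∈ g F) :
    ∃ F : FractionalIdeal R⁰ K, F ≤ J ∧ (F : Submodule R K).FG ∧ N ≤ g F := by
  induction N, hN using Submodule.fg_induction with
  | singleton x =>
    obtain ⟨F, h1, h2, h3⟩ := h x (Submodule.mem_span_singleton_self x)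
    exact ⟨F, h1, h2, by simpa using h3⟩
  | sup N₁ N₂ _ _ ih1 ih2 =>
    obtain ⟨F, h1, h2, h3⟩ := ih1 fun x hx => h x (Submodule.mem_sup_left hx)
    obtain ⟨G, k1, k2, k3⟩ := ih2 fun x hx => h x (Submodule.mem_sup_right hx)
    refine ⟨F ⊔ G, sup_le h1 k1, ?_, sup_le (h3.trans (hg le_sup_left))
      (k3.trans (hg le_sup_right))⟩
    rw [FractionalIdeal.coe_sup]
    exact h2.sup k2

theorem aux_inv_ne {I : FractionalIdeal R⁰ K} (hI : I ≠ 0) : I⁻¹ ≠ 0 := by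
  intro h
  have := FractionalIdeal.bot_lt_mul_inv (I := I) hI
  rw [h, mul_zero] at this
  exact lt_irrefl _ this

theorem aux_le_inv {A B : FractionalIdeal R⁰ K} (hB : B ≠ 0) : A ≤ B⁻¹ ↔ A * B ≤ 1 := by
  rw [FractionalIdeal.inv_eq, FractionalIdeal.le_div_iff_mul_le hB]

theorem aux_le_v (I : FractionalIdeal R⁰ K) : I ≤ I⁻¹⁻¹ := by
  by_cases hI : I = 0
  · rw [hI]; exact FractionalIdeal.zero_le _
  · rw [aux_le_inv (aux_inv_ne hI)]
    exact FractionalIdeal.mul_one_div_le_one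

theorem aux_v_mono {A B : FractionalIdeal R⁰ K} (h : A ≤ B) : A⁻¹⁻¹ ≤ B⁻¹⁻¹ := by
  by_cases hA : A = 0
  · rw [hA, FractionalIdeal.inv_zero', FractionalIdeal.inv_zero']
    exact FractionalIdeal.zero_le _
  · have hB : B ≠ 0 := by
      rintro rfl
      exact hA (FractionalIdeal.le_zero_iff.1 h)
    exact FractionalIdeal.inv_anti_mono (aux_inv_ne hB) (aux_inv_ne hA)
      (FractionalIdeal.inv_anti_mono hA hB h)

theorem aux_mem_t {I : FractionalIdeal R⁰ K} {x : K} (hx : x ∈ tOp K I) :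
    ∃ F : FractionalIdeal R⁰ K, F ≤ I ∧ (F : Submodule R K).FG ∧
      x ∈ ((F⁻¹⁻¹ : FractionalIdeal R⁰ K) : Submodule R K) := by
  let T : Submodule R K :=
    { carrier := {x | ∃ F : FractionalIdeal R⁰ K, F ≤ I ∧ (F : Submodule R K).FG ∧
        x ∈ ((F⁻¹⁻¹ : FractionalIdeal R⁰ K) : Submodule R K)}
      zero_mem' := ⟨0, FractionalIdeal.zero_le _, by
        rw [FractionalIdeal.coe_zero]; exact Submodule.fg_bot, Submodule.zero_mem _⟩
      add_mem' := by
        rintro a b ⟨F, h1, h2, h3⟩ ⟨G, k1, k2, k3⟩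
        refine ⟨F ⊔ G, sup_le h1 k1, ?_, Submodule.add_mem _ (aux_v_mono le_sup_left h3)
          (aux_v_mono le_sup_right k3)⟩
        rw [FractionalIdeal.coe_sup]
        exact h2.sup k2
      smul_mem' := by
        rintro c x ⟨F, h1, h2, h3⟩
        exact ⟨F, h1, h2, Submodule.smul_mem _ c h3⟩ }
  have : tOp K I ≤ T := by
    unfold tOp
    refine iSup_le fun J => iSup_le fun _ => iSup_le fun h1 => iSup_le fun h2 => ?_
    exact fun x hx => ⟨J, h1, h2, hx⟩
  exact this hx

theorem aux_v_le_t {I J : FractionalIdeal R⁰ K} (h0 : J ≠ 0) (h : J ≤ I)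
    (hf : (J : Submodule R K).FG) : ((J⁻¹⁻¹ : FractionalIdeal R⁰ K) : Submodule R K) ≤ tOp K I :=
  le_iSup_of_le J (le_iSup_of_le h0 (le_iSup_of_le h (le_iSup_of_le hf le_rfl)))

theorem aux_t_mono {I J : FractionalIdeal R⁰ K} (h : J ≤ I) : tOp K J ≤ tOp K I := by
  conv_lhs => unfold tOp
  exact iSup_le fun F => iSup_le fun h0 => iSup_le fun h1 => iSup_le fun h2 =>
    aux_v_le_t h0 (h1.trans h) h2

theorem aux_mul {J B : FractionalIdeal R⁰ K} {x : K} (hx : x ∈ J * B) :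
    ∃ F : FractionalIdeal R⁰ K, F ≤ J ∧ (F : Submodule R K).FG ∧
      x ∈ ((F * B : FractionalIdeal R⁰ K) : Submodule R K) := by
  obtain ⟨T, T', h1, h2, h3⟩ := FractionalIdeal.mem_span_mul_finite_of_mem_mul hx
  have hT : (Submodule.span R (T : Set K)).FG := Submodule.fg_span T.finite_toSet
  obtain ⟨F, hF⟩ : ∃ F : FractionalIdeal R⁰ K, (F : Submodule R K) = Submodule.span R (T : Set K) :=
    ⟨⟨_, FractionalIdeal.isFractional_of_fg hT⟩, rfl⟩
  refine ⟨F, ?_, hF ▸ hT, ?_⟩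
  · rw [← FractionalIdeal.coe_le_coe, hF]
    exact Submodule.span_le.2 h1
  · rw [FractionalIdeal.coe_mul, hF]
    rw [← Submodule.span_mul_span] at h3
    exact mul_le_mul' le_rfl (Submodule.span_le.2 h2) h3

end helpers

/-- Every `v`-domain has the finite `t`-basic ideal property: if every nonzero finitely
generated ideal `I` of `R` satisfies `(I·I⁻¹)_v = R`, then every nonzero finitely generated
ideal of `R` is `t`-basic. -/
theorem finite_t_basic_of_v_domain
    {R K : Type*} [CommRing R] [IsDomain R] [Field K] [Algebra R K] [IsFractionRing R K]
    (hv : ∀ I : Ideal R, I ≠ ⊥ → I.FG →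
      (((I : FractionalIdeal R⁰ K) * (I : FractionalIdeal R⁰ K)⁻¹)⁻¹)⁻¹ = 1) :
    ∀ I : Ideal R, I ≠ ⊥ → I.FG →
      ∀ J : Ideal R, J ≠ ⊥ → J ≤ I →
        (∃ n : ℕ, tOp K ((J : FractionalIdeal R⁰ K) * (I : FractionalIdeal R⁰ K) ^ n)
            = tOp K ((I : FractionalIdeal R⁰ K) ^ (n + 1))) →
        tOp K (J : FractionalIdeal R⁰ K) = tOp K (I : FractionalIdeal R⁰ K) := by
  intro I hI hIf J hJ hJI ⟨n, hn⟩
  have hI0 : (I : FractionalIdeal R⁰ K) ≠ 0 := FractionalIdeal.coeIdeal_ne_zero.2 hI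
  have inj : Function.Injective (algebraMap R K) := IsFractionRing.injective R K
  have hIf' : ((I : FractionalIdeal R⁰ K) : Submodule R K).FG :=
    (FractionalIdeal.coeIdeal_fg R⁰ inj I).2 hIf
  have hpf : (((I : FractionalIdeal R⁰ K) ^ (n + 1) : FractionalIdeal R⁰ K) : Submodule R K).FG := by
    rw [FractionalIdeal.coe_pow]; exact hIf'.pow _
  have hp0 : (I : FractionalIdeal R⁰ K) ^ (n + 1) ≠ 0 := by
    rw [← FractionalIdeal.coeIdeal_pow]
    exact FractionalIdeal.coeIdeal_ne_zero.2 (pow_ne_zero _ hI)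
  have hB0 : (I : FractionalIdeal R⁰ K) ^ n ≠ 0 := by
    rw [← FractionalIdeal.coeIdeal_pow]
    exact FractionalIdeal.coeIdeal_ne_zero.2 (pow_ne_zero _ hI)
  have hvn := hv (I ^ n) (pow_ne_zero _ hI) (hIf.pow)
  rw [FractionalIdeal.coeIdeal_pow] at hvn
  have hJI' : (J : FractionalIdeal R⁰ K) ≤ I := (FractionalIdeal.coeIdeal_le_coeIdeal K).2 hJI
  refine le_antisymm (aux_t_mono hJI') ?_
  set i : FractionalIdeal R⁰ K := (I : FractionalIdeal R⁰ K) with hi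
  set j : FractionalIdeal R⁰ K := (J : FractionalIdeal R⁰ K) with hj
  -- choose the finitely generated subideals
  obtain ⟨A, hA1, hA2, hA3⟩ := aux_fg
    (fun F : FractionalIdeal R⁰ K => ((F⁻¹⁻¹ : FractionalIdeal R⁰ K) : Submodule R K))
    (fun _ _ h => aux_v_mono h) (j * i ^ n) _ hpf (fun x hx => aux_mem_t (by
      rw [hn]
      exact aux_v_le_t hp0 le_rfl hpf (aux_le_v _ hx)))
  obtain ⟨F, hF1, hF2, hF3⟩ := aux_fg
    (fun F : FractionalIdeal R⁰ K => ((F * i ^ n : FractionalIdeal R⁰ K) : Submodule R K))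
    (fun _ _ h => mul_le_mul_left h _) j _ hA2 (fun x hx => aux_mul (hA1 hx))
  have hA3' : i ^ (n + 1) ≤ A⁻¹⁻¹ := hA3
  have hF3' : A ≤ F * i ^ n := hF3
  have hle : i ^ (n + 1) ≤ (F * i ^ n)⁻¹⁻¹ := hA3'.trans (aux_v_mono hF3')
  have hFB0 : F * i ^ n ≠ 0 := by
    intro h
    rw [h, FractionalIdeal.inv_zero', FractionalIdeal.inv_zero'] at hle
    exact hp0 (FractionalIdeal.le_zero_iff.1 hle)
  have hF0 : F ≠ 0 := by
    rintro rfl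
    exact hFB0 (zero_mul _)
  rw [aux_le_inv (aux_inv_ne hFB0)] at hle
  have h1 : F⁻¹ * (i ^ n)⁻¹ ≤ (F * i ^ n)⁻¹ := by
    rw [aux_le_inv hFB0, show F⁻¹ * (i ^ n)⁻¹ * (F * i ^ n) = (F * F⁻¹) * (i ^ n * (i ^ n)⁻¹) by ring]
    calc (F * F⁻¹) * (i ^ n * (i ^ n)⁻¹) ≤ 1 * 1 :=
          mul_le_mul' FractionalIdeal.mul_one_div_le_one FractionalIdeal.mul_one_div_le_one
      _ = 1 := one_mul 1
  have h2 : (i * F⁻¹) * (i ^ n * (i ^ n)⁻¹) ≤ 1 := by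
    calc (i * F⁻¹) * (i ^ n * (i ^ n)⁻¹) = i ^ (n + 1) * (F⁻¹ * (i ^ n)⁻¹) := by ring
      _ ≤ i ^ (n + 1) * (F * i ^ n)⁻¹ := mul_le_mul_right h1 _
      _ ≤ 1 := hle
  have hC0 : i ^ n * (i ^ n)⁻¹ ≠ 0 := (FractionalIdeal.bot_lt_mul_inv hB0).ne'
  have h3 : i * F⁻¹ ≤ 1 := by
    rw [← aux_le_inv hC0] at h2
    have h4 := aux_le_v (i ^ n * (i ^ n)⁻¹)⁻¹
    rw [hvn, inv_one] at h4
    exact h2.trans h4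
  rw [← aux_le_inv (aux_inv_ne hF0)] at h3
  have h5 : i⁻¹⁻¹ ≤ F⁻¹⁻¹ := by
    refine FractionalIdeal.inv_anti_mono (aux_inv_ne hF0) (aux_inv_ne hI0) ?_
    rw [aux_le_inv hI0, mul_comm, ← aux_le_inv (aux_inv_ne hF0)]
    exact h3
  conv_lhs => unfold tOp
  refine iSup_le fun G => iSup_le fun _ => iSup_le fun g1 => iSup_le fun _ => ?_
  exact le_trans (show G⁻¹⁻¹ ≤ F⁻¹⁻¹ from (aux_v_mono g1).trans h5) (aux_v_le_t hF0 hF1 hF2)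
end

section
/- Let k be a field, T = k[x,y] the polynomial ring in two indeterminates, M = (x,y)T, and R = k + M² (a subring of T with quotient field K = k(x,y)). Then, computing inverses and v-closures of fractional ideals of R: (R : M) = M (so M_v = M), (R : T) = M², (R : M²) = T, (M²)_v = M², and (M^n)_v = M² for every integer n ≥ 2. -/
noncomputable section

variable (k : Type*) [Field k]

/-- `T = k[x,y]`, the polynomial ring in two indeterminates over `k`. -/
abbrev PolyT := MvPolynomial (Fin 2) k

/-- The maximal ideal `M = (x,y)T` of `T = k[x,y]`. -/
def idealM : Ideal (PolyT k) := Ideal.span {MvPolynomial.X 0, MvPolynomial.X 1}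

/-- The subring `R = k + M²` of `T = k[x,y]`: the preimage under `T → T/M²` of the image
of `k`, i.e. the set of polynomials `f` with `f - c ∈ M²` for some `c ∈ k`. -/
def subR : Subalgebra k (PolyT k) :=
  Subalgebra.comap (Ideal.Quotient.mkₐ k (idealM k ^ 2)) ⊥

/-- The common quotient field `K = k(x,y)` of `T` and `R`. -/
abbrev FieldK := FractionRing (PolyT k)

/-- `M` regarded as an `R`-submodule (fractional `R`-ideal) of `K = k(x,y)`. -/
def subM : Submodule (subR k) (FieldK k) :=
  Submodule.span (subR k) (algebraMap (PolyT k) (FieldK k) '' (idealM k : Set (PolyT k)))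

/-- `T` regarded as an `R`-submodule (fractional `R`-ideal) of `K = k(x,y)`. -/
def subT : Submodule (subR k) (FieldK k) :=
  Submodule.span (subR k) (Set.range (algebraMap (PolyT k) (FieldK k)))

theorem aux_idealM_eq : idealM k = MvPolynomial.idealOfVars (Fin 2) k := by
  rw [idealM, MvPolynomial.idealOfVars]
  congr 1
  ext f
  simp [Fin.exists_fin_two, eq_comm]

theorem aux_X_mem (i : Fin 2) : (MvPolynomial.X i : PolyT k) ∈ idealM k := by
  rw [aux_idealM_eq]
  exact Ideal.subset_span ⟨i, rfl⟩

theorem aux_mem_R (f : PolyT k) :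
    f ∈ subR k ↔ ∃ c : k, f - MvPolynomial.C c ∈ idealM k ^ 2 := by
  rw [subR, Subalgebra.mem_comap, Algebra.mem_bot]
  constructor
  · rintro ⟨c, hc⟩
    refine ⟨c, ?_⟩
    rw [← Ideal.Quotient.eq]
    exact hc.symm
  · rintro ⟨c, hc⟩
    refine ⟨c, ?_⟩
    rw [← Ideal.Quotient.eq] at hc
    exact hc.symm

theorem aux_sq_mem_R {f : PolyT k} (hf : f ∈ idealM k ^ 2) : f ∈ subR k :=
  (aux_mem_R k f).2 ⟨0, by simpa using hf⟩

theorem aux_coeff_R {f : PolyT k} (hf : f ∈ subR k) (i : Fin 2) :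
    MvPolynomial.coeff (Finsupp.single i 1) f = 0 := by
  obtain ⟨c, hc⟩ := (aux_mem_R k f).1 hf
  rw [aux_idealM_eq, MvPolynomial.mem_pow_idealOfVars_iff'] at hc
  have := hc (Finsupp.single i 1) (by simp)
  have h0 : (0 : Fin 2 →₀ ℕ) ≠ Finsupp.single i 1 := by
    intro h
    simpa using DFunLike.congr_fun h i
  simpa [MvPolynomial.coeff_C, h0] using this

theorem aux_sub_const (f : PolyT k) (hf : MvPolynomial.coeff 0 f = 0) : f ∈ idealM k := by
  rw [← pow_one (idealM k), aux_idealM_eq, MvPolynomial.mem_pow_idealOfVars_iff']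
  intro x hx
  have : x = 0 := by
    rw [← Finsupp.degree_eq_zero_iff]; omega
  rw [this, hf]

theorem aux_mem_M {f : PolyT k} (hf : f * MvPolynomial.X 0 ∈ subR k) : f ∈ idealM k := by
  apply aux_sub_const
  have h := aux_coeff_R k hf 0
  have h2 := MvPolynomial.coeff_mul_X (0 : Fin 2 →₀ ℕ) (0 : Fin 2) f
  rw [zero_add] at h2
  rw [← h2, h]

theorem aux_mem_Msq {f : PolyT k} (hf : f ∈ subR k) (hM : f ∈ idealM k) : f ∈ idealM k ^ 2 := by
  obtain ⟨c, hc⟩ := (aux_mem_R k f).1 hf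
  have h1 : f - MvPolynomial.C c ∈ idealM k := Ideal.pow_le_self two_ne_zero hc
  have h2 : (MvPolynomial.C c : PolyT k) ∈ idealM k := by
    have := Ideal.sub_mem _ hM h1
    simpa using this
  have h3 : c = 0 := by
    rw [← pow_one (idealM k), aux_idealM_eq, MvPolynomial.mem_pow_idealOfVars_iff'] at h2
    simpa using h2 0 (by simp)
  simpa [h3] using hc

/-- the image in `K` of an ideal of `T`, as an `R`-submodule -/
def auxJ (I : Ideal (PolyT k)) : Submodule (subR k) (FieldK k) :=
  (I.restrictScalars (subR k)).map
    (IsScalarTower.toAlgHom (subR k) (PolyT k) (FieldK k)).toLinearMap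

theorem aux_mem_J (I : Ideal (PolyT k)) (u : FieldK k) :
    u ∈ auxJ k I ↔ ∃ f ∈ I, algebraMap (PolyT k) (FieldK k) f = u := Iff.rfl

theorem aux_subM : subM k = auxJ k (idealM k) := by
  apply le_antisymm
  · rw [subM, Submodule.span_le]
    exact fun u hu => hu
  · intro u hu
    exact Submodule.subset_span hu

theorem aux_subT : subT k = auxJ k ⊤ := by
  apply le_antisymm
  · rw [subT, Submodule.span_le]
    rintro _ ⟨f, rfl⟩
    exact ⟨f, trivial, rfl⟩
  · rintro _ ⟨f, -, rfl⟩
    exact Submodule.subset_span ⟨f, rfl⟩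

theorem aux_subM_pow (n : ℕ) (hn : n ≠ 0) : subM k ^ n = auxJ k (idealM k ^ n) := by
  rw [aux_subM, auxJ, auxJ, Submodule.restrictScalars_pow hn, Submodule.map_pow]

theorem aux_mem_one (u : FieldK k) : u ∈ (1 : Submodule (subR k) (FieldK k)) ↔
    ∃ f ∈ subR k, algebraMap (PolyT k) (FieldK k) f = u := by
  rw [Submodule.mem_one]
  constructor
  · rintro ⟨y, rfl⟩
    exact ⟨y, y.2, rfl⟩
  · rintro ⟨f, hf, rfl⟩
    exact ⟨⟨f, hf⟩, rfl⟩

theorem aux_mem_one_alg (f : PolyT k) :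
    algebraMap (PolyT k) (FieldK k) f ∈ (1 : Submodule (subR k) (FieldK k)) ↔ f ∈ subR k := by
  rw [aux_mem_one]
  constructor
  · rintro ⟨g, hg, h⟩
    rwa [← IsFractionRing.injective (PolyT k) (FieldK k) h]
  · intro h
    exact ⟨f, h, rfl⟩

theorem aux_int (n : ℕ) (u : FieldK k)
    (hu : u ∈ (1 : Submodule (subR k) (FieldK k)) / auxJ k (idealM k ^ n)) :
    ∃ f, algebraMap (PolyT k) (FieldK k) f = u := by
  rw [Submodule.mem_div_iff_forall_mul_mem] at hu
  have h (i : Fin 2) := (aux_mem_one k _).1 (hu _ ⟨MvPolynomial.X i ^ n,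
    Ideal.pow_mem_pow (aux_X_mem k i) n, rfl⟩)
  obtain ⟨p, -, hp⟩ := h 0
  obtain ⟨q, -, hq⟩ := h 1
  change _ = u * algebraMap (PolyT k) (FieldK k) (MvPolynomial.X 0 ^ n) at hp
  change _ = u * algebraMap (PolyT k) (FieldK k) (MvPolynomial.X 1 ^ n) at hq
  have e : p * MvPolynomial.X 1 ^ n = q * MvPolynomial.X 0 ^ n := by
    apply IsFractionRing.injective (PolyT k) (FieldK k)
    rw [map_mul, map_mul, hp, hq]
    ring
  have hd : (MvPolynomial.X 0 : PolyT k) ^ n ∣ p := by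
    apply (MvPolynomial.X_prime (R := k) (i := (0 : Fin 2))).pow_dvd_of_dvd_mul_right n
      (b := MvPolynomial.X 1 ^ n)
    · intro h
      have := (MvPolynomial.X_prime (R := k) (i := (0 : Fin 2))).dvd_of_dvd_pow h
      rw [MvPolynomial.X_dvd_X] at this
      exact absurd this (by decide)
    · exact ⟨q, by rw [e, mul_comm]⟩
  obtain ⟨r, rfl⟩ := hd
  refine ⟨r, ?_⟩
  have hx : algebraMap (PolyT k) (FieldK k) (MvPolynomial.X 0 ^ n) ≠ 0 := by
    rw [Ne, IsFractionRing.to_map_eq_zero_iff]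
    exact pow_ne_zero _ (MvPolynomial.X_ne_zero _)
  apply mul_right_cancel₀ hx
  rw [← hp, ← map_mul, mul_comm]

theorem aux_div_M : (1 : Submodule (subR k) (FieldK k)) / subM k = subM k := by
  rw [aux_subM]
  ext u
  constructor
  · intro hu
    obtain ⟨f, rfl⟩ := aux_int k 1 u (by rwa [pow_one])
    refine ⟨f, aux_mem_M k ?_, rfl⟩
    rw [← aux_mem_one_alg, map_mul]
    exact hu _ ⟨_, aux_X_mem k 0, rfl⟩
  · rintro ⟨f, hf, rfl⟩
    rw [Submodule.mem_div_iff_forall_mul_mem]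
    rintro _ ⟨g, hg, rfl⟩
    refine (aux_mem_one k _).2 ⟨f * g, aux_sq_mem_R k ?_, map_mul _ _ _⟩
    rw [pow_two]
    exact Ideal.mul_mem_mul hf hg

theorem aux_div_T : (1 : Submodule (subR k) (FieldK k)) / subT k = subM k ^ 2 := by
  rw [aux_subT, aux_subM_pow k 2 two_ne_zero]
  ext u
  constructor
  · intro hu
    have h (g : PolyT k) : u * algebraMap (PolyT k) (FieldK k) g ∈
      (1 : Submodule (subR k) (FieldK k)) := hu _ ⟨g, trivial, rfl⟩
    have h1 := h 1
    rw [map_one, mul_one] at h1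
    obtain ⟨f, hf, rfl⟩ := (aux_mem_one k u).1 h1
    refine ⟨f, aux_mem_Msq k hf (aux_mem_M k ?_), rfl⟩
    rw [← aux_mem_one_alg, map_mul]
    exact h _
  · rintro ⟨f, hf, rfl⟩
    rw [Submodule.mem_div_iff_forall_mul_mem]
    rintro _ ⟨g, hg, rfl⟩
    exact (aux_mem_one k _).2 ⟨f * g, aux_sq_mem_R k (Ideal.mul_mem_right _ _ hf), map_mul _ _ _⟩

theorem aux_div_pow (n : ℕ) (hn : 2 ≤ n) :
    (1 : Submodule (subR k) (FieldK k)) / subM k ^ n = subT k := by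
  rw [aux_subT, aux_subM_pow k n (by omega)]
  ext u
  constructor
  · intro hu
    obtain ⟨f, rfl⟩ := aux_int k n u hu
    exact ⟨f, trivial, rfl⟩
  · rintro ⟨f, hf, rfl⟩
    rw [Submodule.mem_div_iff_forall_mul_mem]
    rintro _ ⟨g, hg, rfl⟩
    exact (aux_mem_one k _).2 ⟨f * g, aux_sq_mem_R k
      (Ideal.mul_mem_left _ _ (Ideal.pow_le_pow_right hn hg)), map_mul _ _ _⟩

/-- Let `T = k[x,y]`, `M = (x,y)T` and `R = k + M²`.  Then, for fractional ideals of `R`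
(with `(R : A) = 1/A` and `A_v = 1/(1/A)` computed as `R`-submodules of `K = k(x,y)`):
`(R : M) = M` (so `M_v = M`), `(R : T) = M²`, `(R : M²) = T`, `(M²)_v = M²`, and
`(Mⁿ)_v = M²` for every `n ≥ 2`. -/
theorem kplusMsq_inverses_and_v_closures :
    (1 : Submodule (subR k) (FieldK k)) / subM k = subM k
      ∧ (1 : Submodule (subR k) (FieldK k)) / ((1 : Submodule (subR k) (FieldK k)) / subM k)
          = subM k
      ∧ (1 : Submodule (subR k) (FieldK k)) / subT k = subM k ^ 2
      ∧ (1 : Submodule (subR k) (FieldK k)) / (subM k ^ 2) = subT k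
      ∧ (1 : Submodule (subR k) (FieldK k)) / ((1 : Submodule (subR k) (FieldK k)) / subM k ^ 2)
          = subM k ^ 2
      ∧ ∀ n : ℕ, 2 ≤ n →
          (1 : Submodule (subR k) (FieldK k)) /
              ((1 : Submodule (subR k) (FieldK k)) / subM k ^ n)
            = subM k ^ 2 := by
  refine ⟨aux_div_M k, ?_, aux_div_T k, aux_div_pow k 2 le_rfl, ?_, ?_⟩
  · rw [aux_div_M, aux_div_M]
  · rw [aux_div_pow k 2 le_rfl, aux_div_T]
  · intro n hn
    rw [aux_div_pow k n hn, aux_div_T]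

end
end
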